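/- Let f : ℝ → ℝ be convex, let a < b, let s = (f(b) − f(a))/(b − a), and let c ∈ (a,b) be a point at which s is a subgradient of f. Define h⁺(x) = f(a) + s·(x − a) and ℓ(x) = (f(c) + h⁺(c))/2 + s·(x − c). Then f(a) − ℓ(a) = −(f(c) − ℓ(c)) = f(b) − ℓ(b) = (h⁺(c) − f(c))/2, and sup_{x ∈ [a,b]} |f(x) − ℓ(x)| = (h⁺(c) − f(c))/2. -/

import Mathlib

/-- A convex function lies below its secant line between the endpoints of the secant. -/
theorem ConvexOn.le_secant_line {t : Set ℝ} {f : ℝ → ℝ} (hf : ConvexOn ℝ t f) {a b x : ℝ}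
    (ha : a ∈ t) (hb : b ∈ t) (hab : a < b) (hx : x ∈ Set.Icc a b) :
    f x ≤ f a + (f b - f a) / (b - a) * (x - a) := by
  have hba : 0 < b - a := sub_pos.mpr hab
  have h := hf.2 ha hb (div_nonneg (sub_nonneg.mpr hx.2) hba.le)
    (div_nonneg (sub_nonneg.mpr hx.1) hba.le) (by field_simp; ring)
  simp only [smul_eq_mul] at h
  have hcomb : (b - x) / (b - a) * a + (x - a) / (b - a) * b = x := by
    field_simp
    ring
  rw [hcomb] at h
  refine h.trans_eq ?_
  field_simp
  ring

/-- Equioscillation property of the best uniform affine approximation of a convex `f` on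
`[a,b]`: with `s = (f b - f a)/(b - a)` a subgradient at `c ∈ (a,b)`,
`h⁺(x) = f a + s (x - a)` and `ℓ(x) = (f c + h⁺ c)/2 + s (x - c)`, the errors at `a`, `c`, `b`
equioscillate with value `(h⁺ c - f c)/2`, which is also the uniform error on `[a,b]`. -/
theorem equioscillation_values (f : ℝ → ℝ) (hf : ConvexOn ℝ Set.univ f) (a b c : ℝ)
    (hab : a < b) (hc : c ∈ Set.Ioo a b)
    (hsub : ∀ y : ℝ, f y ≥ f c + (f b - f a) / (b - a) * (y - c)) :
    (f a - ((f c + (f a + (f b - f a) / (b - a) * (c - a))) / 2 +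
        (f b - f a) / (b - a) * (a - c)) =
      ((f a + (f b - f a) / (b - a) * (c - a)) - f c) / 2) ∧
    (-(f c - ((f c + (f a + (f b - f a) / (b - a) * (c - a))) / 2 +
        (f b - f a) / (b - a) * (c - c))) =
      ((f a + (f b - f a) / (b - a) * (c - a)) - f c) / 2) ∧
    (f b - ((f c + (f a + (f b - f a) / (b - a) * (c - a))) / 2 +
        (f b - f a) / (b - a) * (b - c)) =
      ((f a + (f b - f a) / (b - a) * (c - a)) - f c) / 2) ∧
    sSup ((fun x =>
        |f x - ((f c + (f a + (f b - f a) / (b - a) * (c - a))) / 2 +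
          (f b - f a) / (b - a) * (x - c))|) '' Set.Icc a b) =
      ((f a + (f b - f a) / (b - a) * (c - a)) - f c) / 2 := by
  have hchord : ∀ x ∈ Set.Icc a b, f x ≤ f a + (f b - f a) / (b - a) * (x - a) :=
    fun x hx => hf.le_secant_line (Set.mem_univ a) (Set.mem_univ b) hab hx
  have hslope : (f b - f a) / (b - a) * (b - a) = f b - f a :=
    div_mul_cancel₀ _ (sub_pos.mpr hab).ne'
  generalize (f b - f a) / (b - a) = s at *
  have hleft : f a - ((f c + (f a + s * (c - a))) / 2 + s * (a - c)) =
      ((f a + s * (c - a)) - f c) / 2 := by ring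
  refine ⟨hleft, by ring, by linarith, IsGreatest.csSup_eq ⟨⟨a, ⟨le_rfl, hab.le⟩, ?_⟩, ?_⟩⟩
  · have hca := hchord c ⟨hc.1.le, hc.2.le⟩
    simp only [hleft]
    exact abs_of_nonneg (by linarith)
  · rintro _ ⟨x, hx, rfl⟩
    have hupper := hchord x hx
    have hlower := hsub x
    exact abs_le.mpr ⟨by linarith, by linarith⟩
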